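/- Assume (A1). Then lim_{λ→∞} ψ(λ) ∫_λ^∞ dr/ψ(r) = +∞. Equivalently, lim_{t↓0} t ψ(c(t)) = +∞, where c(t) is the unique positive solution of ∫_{c(t)}^∞ dv/ψ(v) = t. -/

import Mathlib

open MeasureTheory Set Filter intervalIntegral

lemma aux_nonneg (x : ℝ) : 0 ≤ Real.exp (-x) - 1 + x := by
  have := Real.add_one_le_exp (-x); linarith

lemma aux_le_min {x : ℝ} (hx : 0 ≤ x) : Real.exp (-x) - 1 + x ≤ min x (x ^ 2) := by
  have h1 : Real.exp (-x) ≤ 1 := Real.exp_le_one_iff.2 (by linarith)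
  refine le_min (by linarith) ?_
  rcases le_total x 1 with h | h
  · have h2 := Real.abs_exp_sub_one_sub_id_le (x := -x) (by rw [abs_neg, abs_of_nonneg hx]; exact h)
    have h3 := (abs_le.1 h2).2
    nlinarith
  · nlinarith

lemma aux_scale {k x : ℝ} (hk : 1 ≤ k) (hx : 0 ≤ x) :
    Real.exp (-(k * x)) - 1 + k * x ≤ k ^ 2 * (Real.exp (-x) - 1 + x) := by
  let g : ℝ → ℝ := fun x => k ^ 2 * (Real.exp (-x) - 1 + x) - (Real.exp (-(k * x)) - 1 + k * x)
  have hd : ∀ y, HasDerivAt g (k ^ 2 * (-Real.exp (-y) + 1) - (-k * Real.exp (-(k * y)) + k)) y := by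
    intro y
    have h1 : HasDerivAt (fun x : ℝ => Real.exp (-x)) (-Real.exp (-y)) y := by
      simpa using (hasDerivAt_id y).neg.exp
    have h2 : HasDerivAt (fun x : ℝ => k * x) k y := by
      simpa using (hasDerivAt_id y).const_mul k
    have h3 : HasDerivAt (fun x : ℝ => Real.exp (-(k * x))) (-k * Real.exp (-(k * y))) y := by
      have := h2.neg.exp
      convert this using 1
      · rfl
      · exact mul_comm (-k) (Real.exp (-(k * y)))
    exact (((h1.sub_const 1).add (hasDerivAt_id y)).const_mul (k ^ 2)).sub
      ((h3.sub_const 1).add h2)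
  have hm : MonotoneOn g (Ici 0) := by
    apply monotoneOn_of_deriv_nonneg (convex_Ici 0)
    · exact fun y _ => (hd y).continuousAt.continuousWithinAt
    · exact fun y _ => (hd y).differentiableAt.differentiableWithinAt
    · intro y hy
      rw [(hd y).deriv]
      have hb := one_add_mul_self_le_rpow_one_add (s := Real.exp (-y) - 1)
        (by linarith [Real.exp_pos (-y)]) hk
      have e : (1 + (Real.exp (-y) - 1)) ^ k = Real.exp (-(k * y)) := by
        rw [add_sub_cancel, ← Real.exp_mul]; congr 1; ring
      rw [e] at hb
      nlinarith
  have := hm (by simp : (0:ℝ) ∈ Ici 0) hx hx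
  simp only [g] at this
  simp at this
  linarith

lemma aux_int {pi : Measure ℝ}
    (hpi : IntegrableOn (fun ℓ => min ℓ (ℓ ^ 2)) (Set.Ioi 0) pi) {l : ℝ} (hl : 0 < l) :
    IntegrableOn (fun ℓ => Real.exp (-l * ℓ) - 1 + l * ℓ) (Ioi 0) pi := by
  refine Integrable.mono' (hpi.const_mul (max l (l ^ 2))) ?_ ?_
  · exact (by fun_prop : Continuous fun ℓ : ℝ => Real.exp (-l * ℓ) - 1 + l * ℓ).aestronglyMeasurable
  · refine (ae_restrict_iff' measurableSet_Ioi).2 (Eventually.of_forall fun x hx => ?_)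
    have hx : 0 < x := hx
    rw [neg_mul, Real.norm_of_nonneg (aux_nonneg _)]
    have h := aux_le_min (x := l * x) (by positivity)
    refine h.trans ?_
    rcases le_total x (x ^ 2) with h | h
    · rw [min_eq_left h]
      exact (min_le_left _ _).trans (mul_le_mul_of_nonneg_right (le_max_left _ _) hx.le)
    · rw [min_eq_right h]
      refine (min_le_right _ _).trans ?_
      rw [mul_pow]
      exact mul_le_mul_of_nonneg_right (le_max_right _ _) (by positivity)

theorem stmt13 (α β : ℝ) (hα : 0 < α) (hβ : 0 ≤ β)
    (pi : Measure ℝ)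
    (hpi : IntegrableOn (fun ℓ => min ℓ (ℓ ^ 2)) (Set.Ioi 0) pi)
    (hnontriv : 0 < β ∨ pi (Set.Ioo 0 1) = ⊤)
    (ψ : ℝ → ℝ)
    (hψ : ∀ l : ℝ, ψ l = α * l + β * l ^ 2 +
      ∫ ℓ in Set.Ioi (0 : ℝ), (Real.exp (-l * ℓ) - 1 + l * ℓ) ∂pi)
    (hA1 : IntegrableOn (fun v => (ψ v)⁻¹) (Set.Ioi 1))
    (c : ℝ → ℝ)
    (hc : ∀ t : ℝ, 0 < t →
      c t ∈ Set.Ioi (0 : ℝ) ∧ (∫ v in Set.Ioi (c t), (ψ v)⁻¹) = t) :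
    Tendsto (fun l => ψ l * ∫ r in Set.Ioi l, (ψ r)⁻¹) atTop atTop
    ∧ Tendsto (fun t => t * ψ (c t)) (nhdsWithin 0 (Set.Ioi 0)) atTop := by
  have hpos : ∀ l, 0 < l → 0 < ψ l := by
    intro l hl
    rw [hψ]
    have : 0 ≤ ∫ ℓ in Set.Ioi (0 : ℝ), (Real.exp (-l * ℓ) - 1 + l * ℓ) ∂pi :=
      integral_nonneg fun x => by
        have := aux_nonneg (l * x)
        simpa [neg_mul] using this
    positivity
  have hscale : ∀ l r, 0 < l → l ≤ r → ψ r ≤ (r / l) ^ 2 * ψ l := by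
    intro l r hl hr
    have hk : 1 ≤ r / l := (one_le_div hl).2 hr
    obtain ⟨k, hkd⟩ : ∃ k, k = r / l := ⟨_, rfl⟩
    rw [← hkd] at hk ⊢
    have hrk : r = k * l := by rw [hkd]; field_simp
    subst hrk
    rw [hψ, hψ, mul_add]
    have h1 : (∫ ℓ in Set.Ioi (0 : ℝ), (Real.exp (-(k * l) * ℓ) - 1 + (k * l) * ℓ) ∂pi)
        ≤ k ^ 2 * ∫ ℓ in Set.Ioi (0 : ℝ), (Real.exp (-l * ℓ) - 1 + l * ℓ) ∂pi := by
      rw [← MeasureTheory.integral_const_mul]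
      refine setIntegral_mono_on (aux_int hpi (by positivity)) ((aux_int hpi hl).const_mul _)
        measurableSet_Ioi fun x hx => ?_
      have hx : 0 < x := hx
      have := aux_scale hk (x := l * x) (by positivity)
      simpa [neg_mul, mul_assoc] using this
    have h2 : α * (k * l) + β * (k * l) ^ 2 ≤ k ^ 2 * (α * l + β * l ^ 2) := by
      have : 0 < α * l := by positivity
      nlinarith [mul_nonneg (mul_nonneg this.le (by linarith : 0 ≤ k)) (sub_nonneg.2 hk)]
    linarith
  have key : ∀ l, 0 < l → IntegrableOn (fun v => (ψ v)⁻¹) (Ioi l) →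
      l ≤ ψ l * ∫ r in Ioi l, (ψ r)⁻¹ := by
    intro l hl hi
    have hp := hpos l hl
    have e : (∫ r in Ioi l, r ^ (-2 : ℝ)) = l⁻¹ := by
      rw [integral_Ioi_rpow_of_lt (by norm_num) hl]
      norm_num [Real.rpow_neg_one]
    have hle : (∫ r in Ioi l, (l ^ 2 / ψ l) * r ^ (-2 : ℝ)) ≤ ∫ r in Ioi l, (ψ r)⁻¹ := by
      refine setIntegral_mono_on ((integrableOn_Ioi_rpow_of_lt (by norm_num) hl).const_mul _) hi
        measurableSet_Ioi fun r hr => ?_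
      have hr : l < r := hr
      have hr0 : 0 < r := hl.trans hr
      have := hscale l r hl hr.le
      have h2 := inv_anti₀ (hpos r hr0) this
      refine le_trans (le_of_eq ?_) h2
      rw [Real.rpow_neg hr0.le, Real.rpow_two]
      field_simp
    rw [MeasureTheory.integral_const_mul, e] at hle
    calc l = ψ l * (l ^ 2 / ψ l * l⁻¹) := by field_simp
      _ ≤ _ := mul_le_mul_of_nonneg_left hle hp.le
  have hI : ∀ l, 1 ≤ l → IntegrableOn (fun v => (ψ v)⁻¹) (Ioi l) := fun l hl =>
    hA1.mono_set (Ioi_subset_Ioi hl)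
  refine ⟨?_, ?_⟩
  · refine tendsto_atTop_mono' _ ?_ tendsto_id
    filter_upwards [eventually_ge_atTop 1] with l hl
    exact key l (by linarith) (hI l hl)
  · have hci : ∀ t, 0 < t → IntegrableOn (fun v => (ψ v)⁻¹) (Ioi (c t)) := by
      intro t ht
      by_contra h
      have := (hc t ht).2
      rw [integral_undef h] at this
      linarith
    rw [tendsto_atTop]
    intro b
    obtain ⟨M, hM⟩ : ∃ M, M = max b 1 := ⟨_, rfl⟩
    have hM1 : 1 ≤ M := hM ▸ le_max_right _ _
    have hMb : b ≤ M := hM ▸ le_max_left _ _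
    have hM0 : 0 < M := by linarith
    have hkM := key M hM0 (hI M hM1)
    have hq : 0 < M / ψ M := div_pos hM0 (hpos M hM0)
    filter_upwards [Ioo_mem_nhdsGT hq] with t ht
    obtain ⟨ht0, ht1⟩ := ht
    obtain ⟨hc0, hct⟩ := hc t ht0
    have hc0 : 0 < c t := hc0
    have hk := key (c t) hc0 (hci t ht0)
    rw [hct] at hk
    have hMc : M ≤ c t := by
      by_contra! h
      have : (∫ v in Ioi M, (ψ v)⁻¹) ≤ ∫ v in Ioi (c t), (ψ v)⁻¹ := by
        refine setIntegral_mono_set (hci t ht0) ?_ (Ioi_subset_Ioi h.le).eventuallyLE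
        refine (ae_restrict_iff' measurableSet_Ioi).2 (Eventually.of_forall fun x hx => ?_)
        exact (inv_pos.2 (hpos x (hc0.trans hx))).le
      rw [hct] at this
      rw [lt_div_iff₀ (hpos M hM0)] at ht1
      nlinarith [hpos M hM0]
    linarith
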